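/- arXiv:0912.2379 — 2 statements merged into one kernel-verified Lean document; each statement's English description precedes it below -/
import Mathlib

section
/- For every α ∈ (0,1) and every n ≥ 1, the number of distinct images of cylinders under T_α^n, i.e. the cardinality of {T_α^n(I_j) : I_j ∈ 𝒫_n}, is at most 2n + 1. -/
open Set

/-- Nakada's α-continued fraction map on `[α-1, α]`. -/
noncomputable def T (α : ℝ) (x : ℝ) : ℝ :=
  if x = 0 then 0 else 1 / |x| - ⌊1 / |x| + 1 - α⌋

/-- The digit of `x` in the α-continued fraction expansion. -/
noncomputable def digit (α x : ℝ) : ℤ := ⌊1 / |x| + 1 - α⌋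

/-- `y` has the same itinerary (digits and signs) as `x` up to time `n`. -/
def sameItin (α : ℝ) (n : ℕ) (x y : ℝ) : Prop :=
  ∀ k < n, digit α ((T α)^[k] y) = digit α ((T α)^[k] x) ∧
    (0 < (T α)^[k] y ↔ 0 < (T α)^[k] x)

/-- The rank-`n` cylinder of `𝒫_n` containing `x`. -/
def cyl (α : ℝ) (n : ℕ) (x : ℝ) : Set ℝ :=
  {y ∈ Icc (α - 1) α | sameItin α n x y}

theorem T_mem (α : ℝ) (hα : α ∈ Ioo (0:ℝ) 1) (x : ℝ) : T α x ∈ Ico (α - 1) α := by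
  obtain ⟨h0, h1⟩ := hα
  unfold T
  split_ifs with h
  · constructor <;> linarith
  · have a := Int.floor_le (1 / |x| + 1 - α)
    have b := Int.lt_floor_add_one (1 / |x| + 1 - α)
    constructor <;> linarith

theorem T_eq (α : ℝ) {x : ℝ} (hx : x ≠ 0) : T α x = 1 / |x| - digit α x := by
  simp [T, digit, hx]

theorem abs_lt_one_of_mem (α : ℝ) (hα : α ∈ Ioo (0:ℝ) 1) {x : ℝ} (hx : x ∈ Icc (α - 1) α) :
    |x| < 1 := by
  obtain ⟨h0, h1⟩ := hα
  obtain ⟨h2, h3⟩ := hx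
  rw [abs_lt]; constructor <;> linarith

theorem digit_pos (α : ℝ) (hα : α ∈ Ioo (0:ℝ) 1) {x : ℝ} (hx : x ∈ Icc (α - 1) α)
    (h : x ≠ 0) : 1 ≤ digit α x := by
  have h1 := abs_lt_one_of_mem α hα hx
  have h2 : 1 ≤ 1 / |x| := by
    rw [le_div_iff₀ (abs_pos.mpr h)]; linarith
  unfold digit
  rw [Int.le_floor]
  push_cast
  linarith [hα.2]

theorem digit_zero (α : ℝ) (hα : α ∈ Ioo (0:ℝ) 1) : digit α 0 = 0 := by
  unfold digit
  rw [Int.floor_eq_iff]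
  obtain ⟨h0, h1⟩ := hα
  simp
  constructor <;> linarith

/-- One-step itinerary agreement. -/
def same1 (α x y : ℝ) : Prop := digit α y = digit α x ∧ (0 < y ↔ 0 < x)

theorem same1_ne (α : ℝ) (hα : α ∈ Ioo (0:ℝ) 1) {x y : ℝ} (hx : x ∈ Icc (α - 1) α)
    (h : x ≠ 0) (hs : same1 α x y) : y ≠ 0 := by
  rintro rfl
  have h1 := digit_pos α hα hx h
  have h2 := digit_zero α hα
  have h3 := hs.1
  omega

theorem sameItin_succ (α : ℝ) (n : ℕ) (x y : ℝ) :
    sameItin α (n + 1) x y ↔ same1 α x y ∧ sameItin α n (T α x) (T α y) := by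
  constructor
  · intro h
    refine ⟨h 0 (by omega), fun k hk => ?_⟩
    have := h (k + 1) (by omega)
    simpa only [Function.iterate_succ_apply] using this
  · rintro ⟨h0, h⟩ k hk
    rcases k with _ | k
    · exact h0
    · simpa only [Function.iterate_succ_apply] using h k (by omega)

theorem cyl_eq (α : ℝ) (n : ℕ) {x y : ℝ} (h : y ∈ cyl α n x) : cyl α n x = cyl α n y := by
  ext z
  constructor
  · rintro ⟨hz, hs⟩
    exact ⟨hz, fun k hk => ⟨(hs k hk).1.trans (h.2 k hk).1.symm,
      (hs k hk).2.trans (h.2 k hk).2.symm⟩⟩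
  · rintro ⟨hz, hs⟩
    exact ⟨hz, fun k hk => ⟨(hs k hk).1.trans (h.2 k hk).1,
      (hs k hk).2.trans (h.2 k hk).2⟩⟩

theorem digit_mono (α : ℝ) {x y : ℝ} (hx : x ≠ 0) (h : |x| ≤ |y|) :
    digit α y ≤ digit α x := by
  unfold digit
  apply Int.floor_le_floor
  have := one_div_le_one_div_of_le (abs_pos.mpr hx) h
  linarith

theorem cyl_convex (α : ℝ) (hα : α ∈ Ioo (0:ℝ) 1) (n : ℕ) : ∀ x ∈ Icc (α - 1) α,
    (∀ k < n, (T α)^[k] x ≠ 0) → ∀ a b c, a ∈ cyl α n x → c ∈ cyl α n x →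
    a ≤ b → b ≤ c → b ∈ cyl α n x := by
  induction n with
  | zero =>
    intro x hx _ a b c ha hc hab hbc
    exact ⟨⟨ha.1.1.trans hab, hbc.trans hc.1.2⟩, fun k hk => by omega⟩
  | succ n ih =>
    intro x hx hne a b c ha hc hab hbc
    have hb : b ∈ Icc (α - 1) α := ⟨ha.1.1.trans hab, hbc.trans hc.1.2⟩
    have hx0 : x ≠ 0 := hne 0 (by omega)
    obtain ⟨haI, ha⟩ := ha
    obtain ⟨hcI, hc⟩ := hc
    rw [sameItin_succ] at ha hc
    have ha0 := same1_ne α hα hx hx0 ha.1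
    have hc0 := same1_ne α hα hx hx0 hc.1
    have key := ih (T α x) (Ico_subset_Icc_self (T_mem α hα x)) (fun k hk => by
      have := hne (k + 1) (by omega)
      simpa only [Function.iterate_succ_apply] using this)
    have hTa : T α a ∈ cyl α n (T α x) := ⟨Ico_subset_Icc_self (T_mem α hα a), ha.2⟩
    have hTc : T α c ∈ cyl α n (T α x) := ⟨Ico_subset_Icc_self (T_mem α hα c), hc.2⟩
    refine ⟨hb, ?_⟩
    rw [sameItin_succ]
    have hda := ha.1.1
    have hdc := hc.1.1
    rcases lt_or_ge 0 x with hpos | hneg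
    · have pa : 0 < a := ha.1.2.2 hpos
      have pb : 0 < b := pa.trans_le hab
      have pc : 0 < c := pb.trans_le hbc
      have l1 : |a| ≤ |b| := by rw [abs_of_pos pa, abs_of_pos pb]; exact hab
      have l2 : |b| ≤ |c| := by rw [abs_of_pos pc, abs_of_pos pb]; exact hbc
      have d1 := digit_mono α pa.ne' l1
      have d2 := digit_mono α pb.ne' l2
      have hd : digit α b = digit α x := by omega
      refine ⟨⟨hd, by simp [hpos, pb]⟩, (key _ _ _ hTc hTa ?_ ?_).2⟩
      · rw [T_eq α hc0, T_eq α pb.ne', hd, hdc]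
        linarith [one_div_le_one_div_of_le (abs_pos.mpr pb.ne') l2]
      · rw [T_eq α ha0, T_eq α pb.ne', hd, hda]
        linarith [one_div_le_one_div_of_le (abs_pos.mpr pa.ne') l1]
    · have pc : c < 0 := lt_of_le_of_ne
        (not_lt.mp fun h => absurd (hc.1.2.1 h) (not_lt.mpr hneg)) hc0
      have pb : b < 0 := hbc.trans_lt pc
      have pa : a < 0 := hab.trans_lt pb
      have l1 : |b| ≤ |a| := by rw [abs_of_neg pa, abs_of_neg pb]; linarith
      have l2 : |c| ≤ |b| := by rw [abs_of_neg pc, abs_of_neg pb]; linarith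
      have d1 := digit_mono α pb.ne l1
      have d2 := digit_mono α pc.ne l2
      have hd : digit α b = digit α x := by omega
      refine ⟨⟨hd, by simp [hneg, pb.le, not_lt.mpr, iff_iff_eq]⟩, (key _ _ _ hTa hTc ?_ ?_).2⟩
      · rw [T_eq α ha0, T_eq α pb.ne, hd, hda]
        linarith [one_div_le_one_div_of_le (abs_pos.mpr pb.ne) l1]
      · rw [T_eq α hc0, T_eq α pb.ne, hd, hdc]
        linarith [one_div_le_one_div_of_le (abs_pos.mpr pc.ne) l2]

/-- Surjectivity of the branch, given that the relevant endpoint does not obstruct. -/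
theorem branch_surj (α : ℝ) (hα : α ∈ Ioo (0:ℝ) 1) {x e z : ℝ} (hx : x ∈ Icc (α - 1) α)
    (hx0 : x ≠ 0) (he : e = if 0 < x then α else α - 1) (hz : z ∈ Ico (α - 1) α)
    (h : same1 α x e → T α e ≤ z) :
    ∃ y ∈ Icc (α - 1) α, same1 α x y ∧ T α y = z := by
  have hd := digit_pos α hα hx hx0
  have hdR : (1:ℝ) ≤ digit α x := by exact_mod_cast hd
  have hw : 0 < z + digit α x := by linarith [hz.1, hα.1]
  have he0 : e ≠ 0 := by
    rw [he]; split_ifs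
    · exact hα.1.ne'
    · linarith [hα.2]
  have hxe : |x| ≤ |e| := by
    rw [he]; split_ifs with hp
    · rw [abs_of_pos hp, abs_of_pos hα.1]; exact hx.2
    · rw [abs_of_nonpos (not_lt.mp hp), abs_of_neg (by linarith [hα.2])]; linarith [hx.1]
  have hse : (0 < e ↔ 0 < x) := by
    rw [he]; split_ifs with hp
    · simp [hp, hα.1]
    · simp only [hp, iff_false]; linarith [hα.2]
  have hwe : 1 / |e| ≤ z + digit α x := by
    rcases (digit_mono α hx0 hxe).eq_or_lt with heq | hlt
    · have := h ⟨heq, hse⟩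
      rw [T_eq α he0, heq] at this
      linarith
    · have h1 : (digit α e : ℝ) + 1 ≤ digit α x := by exact_mod_cast hlt
      have h2 := (T_mem α hα e).2
      rw [T_eq α he0] at h2
      linarith [hz.1]
  have hwe' : 1 / (z + digit α x) ≤ |e| := by
    rw [div_le_iff₀ hw]
    rw [div_le_iff₀ (abs_pos.mpr he0)] at hwe
    linarith
  have hiw : 0 < 1 / (z + digit α x) := by positivity
  have main : ∀ y, |y| = 1 / (z + digit α x) → y ≠ 0 ∧ digit α y = digit α x ∧ T α y = z := by
    intro y hy
    have hy0 : y ≠ 0 := by rw [← abs_pos, hy]; exact hiw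
    have hdy : digit α y = digit α x := by
      unfold digit at hy ⊢
      rw [Int.floor_eq_iff, hy, one_div_one_div]
      constructor <;> linarith [hz.1, hz.2]
    refine ⟨hy0, hdy, ?_⟩
    rw [T_eq α hy0, hdy, hy, one_div_one_div]
    ring
  rcases lt_or_ge 0 x with hp | hn
  · obtain ⟨-, h2, h3⟩ := main (1 / (z + digit α x)) (abs_of_pos hiw)
    rw [he, if_pos hp, abs_of_pos hα.1] at hwe'
    exact ⟨_, ⟨by linarith [hα.2], hwe'⟩, ⟨h2, by simp only [hp, hiw]⟩, h3⟩
  · obtain ⟨-, h2, h3⟩ := main (-(1 / (z + digit α x))) (by rw [abs_neg]; exact abs_of_pos hiw)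
    rw [he, if_neg (not_lt.mpr hn), abs_of_neg (by linarith [hα.2])] at hwe'
    refine ⟨_, ⟨by linarith, by linarith [hα.1]⟩, ⟨h2, ?_⟩, h3⟩
    constructor <;> intro <;> linarith

theorem image_cyl_succ (α : ℝ) (hα : α ∈ Ioo (0:ℝ) 1) (n : ℕ) {x : ℝ} (hx : x ∈ Icc (α - 1) α)
    (hne : ∀ k < n + 1, (T α)^[k] x ≠ 0) (h1 : α ∉ cyl α (n + 1) x)
    (h2 : α - 1 ∉ cyl α (n + 1) x) :
    T α '' cyl α (n + 1) x = cyl α n (T α x) \ {α} := by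
  have hx0 : x ≠ 0 := hne 0 (by omega)
  ext z
  constructor
  · rintro ⟨y, ⟨hy, hs⟩, rfl⟩
    rw [sameItin_succ] at hs
    exact ⟨⟨Ico_subset_Icc_self (T_mem α hα y), hs.2⟩, (T_mem α hα y).2.ne⟩
  · rintro ⟨hz, hzα⟩
    have hzI : z ∈ Ico (α - 1) α := ⟨hz.1.1, lt_of_le_of_ne hz.1.2 hzα⟩
    obtain ⟨e, he⟩ : ∃ e, e = if 0 < x then α else α - 1 := ⟨_, rfl⟩
    have heI : e ∈ Icc (α - 1) α := by
      rw [he]; split_ifs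
      · exact ⟨by linarith, le_rfl⟩
      · exact ⟨le_rfl, by linarith⟩
    have hec : e ∉ cyl α (n + 1) x := by
      rw [he]; split_ifs <;> assumption
    have he0 : e ≠ 0 := by
      rw [he]; split_ifs
      · exact hα.1.ne'
      · linarith [hα.2]
    have hxe : |x| ≤ |e| := by
      rw [he]; split_ifs with hp
      · rw [abs_of_pos hp, abs_of_pos hα.1]; exact hx.2
      · rw [abs_of_nonpos (not_lt.mp hp), abs_of_neg (by linarith [hα.2])]; linarith [hx.1]
    obtain ⟨y, hy, hs, hT⟩ := branch_surj α hα hx hx0 he hzI (by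
      intro hse
      by_contra hlt
      push Not at hlt
      apply hec
      refine ⟨heI, ?_⟩
      rw [sameItin_succ]
      refine ⟨hse, (cyl_convex α hα n (T α x) (Ico_subset_Icc_self (T_mem α hα x))
        (fun k hk => ?_) z (T α e) (T α x) hz
        ⟨Ico_subset_Icc_self (T_mem α hα x), fun k hk => ⟨rfl, Iff.rfl⟩⟩ hlt.le ?_).2⟩
      · have := hne (k + 1) (by omega)
        simpa only [Function.iterate_succ_apply] using this
      · rw [T_eq α he0, T_eq α hx0, hse.1]
        linarith [one_div_le_one_div_of_le (abs_pos.mpr hx0) hxe])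
    refine ⟨y, ⟨hy, ?_⟩, hT⟩
    rw [sameItin_succ]
    exact ⟨hs, by rw [hT]; exact hz.2⟩

theorem not_mem_cyl_left (α : ℝ) (hα : α ∈ Ioo (0:ℝ) 1) (n : ℕ) :
    α ∉ cyl α (n + 1) (α - 1) := by
  rintro ⟨-, h⟩
  have := (h 0 (by omega)).2.1 hα.1
  simp only [Function.iterate_zero, id] at this
  linarith [hα.2]

theorem image_iter_succ (α : ℝ) (n : ℕ) (S : Set ℝ) :
    (T α)^[n + 1] '' S = (T α)^[n] '' (T α '' S) := by
  rw [Function.iterate_succ, image_comp]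

/-- Images of cylinders with the right endpoint removed. -/
theorem image_punctured (α : ℝ) (hα : α ∈ Ioo (0:ℝ) 1) (n : ℕ) : ∀ x ∈ Icc (α - 1) α,
    (∀ k < n, (T α)^[k] x ≠ 0) →
    ((T α)^[n] '' (cyl α n x \ {α}) = Ico (α - 1) α) ∨
    (∃ j ∈ Finset.Icc 1 n, (T α)^[j] '' cyl α j (α - 1) = (T α)^[n] '' (cyl α n x \ {α})) ∨
    (∃ j ∈ Finset.Icc 1 n, (T α)^[j] '' (cyl α j α \ {α}) =
      (T α)^[n] '' (cyl α n x \ {α})) := by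
  induction n with
  | zero =>
    intro x hx _
    left
    ext z
    simp only [Function.iterate_zero, image_id, cyl, sameItin, mem_diff, mem_setOf_eq, mem_Icc,
      mem_Ico, mem_singleton_iff]
    constructor
    · rintro ⟨⟨⟨a, b⟩, -⟩, c⟩
      exact ⟨a, lt_of_le_of_ne b c⟩
    · rintro ⟨a, b⟩
      exact ⟨⟨⟨a, b.le⟩, fun k hk => by omega⟩, b.ne⟩
  | succ n ih =>
    intro x hx hne
    by_cases h1 : α ∈ cyl α (n + 1) x
    · right; right
      exact ⟨n + 1, by simp, by rw [cyl_eq α _ h1]⟩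
    by_cases h2 : α - 1 ∈ cyl α (n + 1) x
    · right; left
      refine ⟨n + 1, by simp, ?_⟩
      rw [cyl_eq α _ h2, diff_singleton_eq_self (not_mem_cyl_left α hα n)]
    rw [diff_singleton_eq_self h1, image_iter_succ, image_cyl_succ α hα n hx hne h1 h2]
    rcases ih (T α x) (Ico_subset_Icc_self (T_mem α hα x)) (fun k hk => by
      have := hne (k + 1) (by omega)
      simpa only [Function.iterate_succ_apply] using this) with h | ⟨j, hj, h⟩ | ⟨j, hj, h⟩
    · exact Or.inl h
    · refine Or.inr (Or.inl ⟨j, ?_, h⟩)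
      rw [Finset.mem_Icc] at hj ⊢; omega
    · refine Or.inr (Or.inr ⟨j, ?_, h⟩)
      rw [Finset.mem_Icc] at hj ⊢; omega

/-- for `α ∈ (0,1)` and `n ≥ 1`, the set of images of rank-`n` cylinders
under `T_α^n` is finite of cardinality at most `2n + 1`. -/
theorem card_images_of_cylinders_le (α : ℝ) (hα : α ∈ Ioo (0:ℝ) 1) (n : ℕ) (hn : 1 ≤ n) :
    letI images := {S : Set ℝ | ∃ x ∈ Icc (α - 1) α,
      (∀ k < n, (T α)^[k] x ≠ 0) ∧ S = (T α)^[n] '' cyl α n x}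
    images.Finite ∧ images.ncard ≤ 2 * n + 1 := by
  classical
  obtain ⟨m, rfl⟩ : ∃ m, n = m + 1 := ⟨n - 1, by omega⟩
  let A : Finset (Set ℝ) :=
    (Finset.Icc 1 (m + 1)).image (fun j => (T α)^[j] '' cyl α j (α - 1))
  let B : Finset (Set ℝ) :=
    (Finset.Icc 1 m).image (fun j => (T α)^[j] '' (cyl α j α \ {α}))
  let F : Finset (Set ℝ) :=
    insert (Ico (α - 1) α) (insert ((T α)^[m + 1] '' cyl α (m + 1) α) (A ∪ B))
  have hF : F.card ≤ 2 * (m + 1) + 1 := by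
    have c1 : A.card ≤ m + 1 := Finset.card_image_le.trans (by simp)
    have c2 : B.card ≤ m := Finset.card_image_le.trans (by simp)
    have c3 := Finset.card_union_le A B
    have c4 := Finset.card_insert_le ((T α)^[m + 1] '' cyl α (m + 1) α) (A ∪ B)
    have c5 := Finset.card_insert_le (Ico (α - 1) α)
      (insert ((T α)^[m + 1] '' cyl α (m + 1) α) (A ∪ B))
    change (insert _ (insert _ _) : Finset (Set ℝ)).card ≤ _
    omega
  have hsub : {S : Set ℝ | ∃ x ∈ Icc (α - 1) α,
      (∀ k < m + 1, (T α)^[k] x ≠ 0) ∧ S = (T α)^[m + 1] '' cyl α (m + 1) x} ⊆ (F : Set (Set ℝ)) := by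
    rintro S ⟨x, hx, hne, rfl⟩
    simp only [F, A, B, Finset.coe_insert, Finset.coe_union, Finset.coe_image, mem_insert_iff,
      mem_union, mem_image, Finset.mem_coe]
    by_cases h1 : α ∈ cyl α (m + 1) x
    · right; left; rw [cyl_eq α _ h1]
    by_cases h2 : α - 1 ∈ cyl α (m + 1) x
    · right; right; left
      exact ⟨m + 1, by simp, by rw [cyl_eq α _ h2]⟩
    rw [image_iter_succ α m (cyl α (m + 1) x), image_cyl_succ α hα m hx hne h1 h2]
    rcases image_punctured α hα m (T α x) (Ico_subset_Icc_self (T_mem α hα x)) (fun k hk => by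
      have := hne (k + 1) (by omega)
      simpa only [Function.iterate_succ_apply] using this) with h | ⟨j, hj, h⟩ | ⟨j, hj, h⟩
    · exact Or.inl h
    · refine Or.inr (Or.inr (Or.inl ⟨j, ?_, h⟩))
      rw [Finset.mem_Icc] at hj ⊢; omega
    · exact Or.inr (Or.inr (Or.inr ⟨j, hj, h⟩))
  refine ⟨F.finite_toSet.subset hsub, ?_⟩
  refine (Set.ncard_le_ncard hsub F.finite_toSet).trans ?_
  rw [Set.ncard_coe_finset]
  exact hF
end

section
/- For α ∈ (0,1], 0 < δ < 1, and K sufficiently large, the unit ball of B_{K,δ} is compact in the L¹([α−1,α]) topology: every sequence f_n with ‖f_n‖_{K,δ} ≤ 1 has a subsequence converging in L¹ to some F with ‖F‖_{K,δ} ≤ 1. -/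
open Set MeasureTheory
open scoped ENNReal

/-- The `(K,δ)`-norm of a function on `I_α = [α-1, α]`:
`sup_{k ≥ K} ( k^{-δ} var_{L_k} g + ∫_{L_k} |g| )`, where
`L_k = [α-1, -1/(k+α)] ∪ [1/(k+α), α]`. -/
noncomputable def kdNorm (α : ℝ) (K : ℕ) (δ : ℝ) (g : ℝ → ℝ) : ℝ≥0∞ :=
  ⨆ k : ℕ, ⨆ _ : K ≤ k,
    (ENNReal.ofReal ((k : ℝ) ^ (-δ)) *
        (eVariationOn g (Icc (1 / (k + α)) α) + eVariationOn g (Icc (α - 1) (-(1 / (k + α))))) +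
      ENNReal.ofReal (∫ x in Icc (α - 1) (-(1 / (k + α))) ∪ Icc (1 / (k + α)) α, |g x|))

open Filter Topology

lemma exists_subseq_countable (D : Set ℝ) (hD : D.Countable) (p : ℕ → ℝ → ℝ) (B : ℝ → ℝ)
    (hB : ∀ n, ∀ x ∈ D, |p n x| ≤ B x) :
    ∃ φ : ℕ → ℕ, StrictMono φ ∧ ∃ P : ℝ → ℝ, ∀ x ∈ D,
      Tendsto (fun n => p (φ n) x) atTop (𝓝 (P x)) := by
  classical
  have : Countable D := hD.to_subtype
  have hc : IsCompact (Set.pi univ (fun d : D => Icc (-B d) (B d))) :=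
    isCompact_univ_pi (fun d => isCompact_Icc)
  obtain ⟨a, -, φ, hφ, h⟩ := hc.tendsto_subseq (x := fun n (d : D) => p n d)
    (fun n d _ => abs_le.1 (hB n d d.2))
  refine ⟨φ, hφ, fun x => if hx : x ∈ D then a ⟨x, hx⟩ else 0, fun x hx => ?_⟩
  have := (tendsto_pi_nhds.1 h) ⟨x, hx⟩
  simpa [hx] using this

lemma helly_mono (s : Set ℝ) (hs : s.OrdConnected) (p : ℕ → ℝ → ℝ)
    (hp : ∀ n, MonotoneOn (p n) s) (B : ℝ → ℝ) (hB : ∀ n, ∀ x ∈ s, |p n x| ≤ B x) :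
    ∃ φ : ℕ → ℕ, StrictMono φ ∧ ∃ P : ℝ → ℝ, ∀ x ∈ s,
      Tendsto (fun n => p (φ n) x) atTop (𝓝 (P x)) := by
  classical
  obtain ⟨φ, hφ, P, hP⟩ := exists_subseq_countable (s ∩ range ((↑) : ℚ → ℝ))
    ((countable_range _).mono inter_subset_right) p B (fun n x hx => hB n x hx.1)
  let u : ℝ → EReal := fun x => limsup (fun n => ((p (φ n) x : ℝ) : EReal)) atTop
  let l : ℝ → EReal := fun x => liminf (fun n => ((p (φ n) x : ℝ) : EReal)) atTop
  have key : ∀ x ∈ s, ∀ y ∈ s, x < y → u x ≤ l y := by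
    intro x hx y hy hxy
    obtain ⟨q, hq1, hq2⟩ := exists_rat_btwn hxy
    have hqs : (q : ℝ) ∈ s := hs.out hx hy ⟨hq1.le, hq2.le⟩
    have ht : Tendsto (fun n => ((p (φ n) q : ℝ) : EReal)) atTop (𝓝 ((P q : ℝ) : EReal)) :=
      EReal.tendsto_coe.2 (hP q ⟨hqs, q, rfl⟩)
    calc u x ≤ limsup (fun n => ((p (φ n) q : ℝ) : EReal)) atTop :=
          limsup_le_limsup (Eventually.of_forall fun n =>
            EReal.coe_le_coe_iff.2 (hp _ hx hqs hq1.le))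
      _ = liminf (fun n => ((p (φ n) q : ℝ) : EReal)) atTop := by
          rw [ht.limsup_eq, ht.liminf_eq]
      _ ≤ l y := liminf_le_liminf (Eventually.of_forall fun n =>
            EReal.coe_le_coe_iff.2 (hp _ hqs hy hq2.le))
  have hE : ({x | x ∈ s ∧ l x < u x} : Set ℝ).Countable := by
    refine Set.PairwiseDisjoint.countable_of_isOpen (s := fun x => Ioo (l x) (u x)) ?_
      (fun _ _ => isOpen_Ioo) (fun x hx => nonempty_Ioo.2 hx.2)
    intro x hx y hy hxy
    refine Set.disjoint_left.2 fun z hz1 hz2 => ?_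
    rcases lt_or_gt_of_ne hxy with h | h
    · exact absurd (hz1.2.trans_le ((key x hx.1 y hy.1 h).trans hz2.1.le)) (lt_irrefl _)
    · exact absurd (hz2.2.trans_le ((key y hy.1 x hx.1 h).trans hz1.1.le)) (lt_irrefl _)
  obtain ⟨ψ, hψ, Q, hQ⟩ := exists_subseq_countable _ hE (fun n => p (φ n)) B
    (fun n x hx => hB _ x hx.1)
  have : ∀ x ∈ s, ∃ L : ℝ, Tendsto (fun n => p (φ (ψ n)) x) atTop (𝓝 L) := by
    intro x hx
    by_cases hb : l x < u x
    · exact ⟨Q x, hQ x ⟨hx, hb⟩⟩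
    · have heq : l x = u x := le_antisymm (liminf_le_limsup) (not_lt.1 hb)
      have ht : Tendsto (fun n => ((p (φ n) x : ℝ) : EReal)) atTop (𝓝 (u x)) :=
        tendsto_of_liminf_eq_limsup heq rfl
      have h1 : u x ≤ ((B x : ℝ) : EReal) := le_of_tendsto' ht fun n =>
        EReal.coe_le_coe_iff.2 (abs_le.1 (hB _ x hx)).2
      have h2 : ((-B x : ℝ) : EReal) ≤ u x := ge_of_tendsto' ht fun n =>
        EReal.coe_le_coe_iff.2 (abs_le.1 (hB _ x hx)).1
      have e : ((u x).toReal : EReal) = u x := EReal.coe_toReal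
        (ne_top_of_le_ne_top (EReal.coe_ne_top _) h1)
        (ne_bot_of_le_ne_bot (EReal.coe_ne_bot _) h2)
      rw [← e] at ht
      exact ⟨(u x).toReal, (EReal.tendsto_coe.1 ht).comp hψ.tendsto_atTop⟩
  choose! R hR using this
  exact ⟨φ ∘ ψ, hφ.comp hψ, R, hR⟩

lemma helly_bv (s : Set ℝ) (hs : s.OrdConnected) (a : ℝ) (ha' : s.Nonempty → a ∈ s) (f : ℕ → ℝ → ℝ)
    (hf : ∀ n, LocallyBoundedVariationOn (f n) s) (B : ℝ → ℝ)
    (hV : ∀ n, ∀ x ∈ s, |variationOnFromTo (f n) s a x| ≤ B x)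
    (hB : ∀ n, ∀ x ∈ s, |f n x| ≤ B x) :
    ∃ φ : ℕ → ℕ, StrictMono φ ∧ ∃ P : ℝ → ℝ, ∀ x ∈ s,
      Tendsto (fun n => f (φ n) x) atTop (𝓝 (P x)) := by
  rcases s.eq_empty_or_nonempty with rfl | hne
  · exact ⟨id, strictMono_id, fun _ => 0, fun x hx => absurd hx (by simp)⟩
  have ha := ha' hne
  obtain ⟨φ, hφ, P, hP⟩ := helly_mono s hs (fun n => variationOnFromTo (f n) s a)
    (fun n => variationOnFromTo.monotoneOn (hf n) ha) B hV
  obtain ⟨ψ, hψ, Q, hQ⟩ := helly_mono s hs (fun n => variationOnFromTo (f (φ n)) s a - f (φ n))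
    (fun n => variationOnFromTo.sub_self_monotoneOn (hf _) ha) (fun x => B x + B x) (by
      intro n x hx
      simp only [Pi.sub_apply]
      exact (abs_sub _ _).trans (add_le_add (hV _ x hx) (hB _ x hx)))
  refine ⟨φ ∘ ψ, hφ.comp hψ, fun x => P x - Q x, fun x hx => ?_⟩
  have h1 := ((hP x hx).comp hψ.tendsto_atTop).sub (hQ x hx)
  refine h1.congr fun n => ?_
  simp

lemma lbv_aemeasurable (s : Set ℝ) (hs : MeasurableSet s) (f : ℝ → ℝ)
    (hf : LocallyBoundedVariationOn f s) : AEMeasurable f (volume.restrict s) := by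
  obtain ⟨p, q, hp, hq, rfl⟩ := hf.exists_monotoneOn_sub_monotoneOn
  exact (aemeasurable_restrict_of_monotoneOn hs hp).sub (aemeasurable_restrict_of_monotoneOn hs hq)

lemma bv_integrableOn (a b : ℝ) (f : ℝ → ℝ)
    (hf : eVariationOn f (Icc a b) ≠ ⊤) : IntegrableOn f (Icc a b) := by
  have hf' : BoundedVariationOn f (Icc a b) := hf
  obtain ⟨p, q, hp, hq, rfl⟩ := hf'.locallyBoundedVariationOn.exists_monotoneOn_sub_monotoneOn
  exact (hp.integrableOn_isCompact isCompact_Icc).sub (hq.integrableOn_isCompact isCompact_Icc)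

lemma point_bound (a b c d V : ℝ) (hV0 : 0 ≤ V) (hcd : c < d) (hsub : Icc c d ⊆ Icc a b)
    (g : ℝ → ℝ) (hV : eVariationOn g (Icc a b) ≤ ENNReal.ofReal V)
    (hI : ∫ x in Icc c d, |g x| ≤ 1) : ∀ x ∈ Icc a b, |g x| ≤ 1 / (d - c) + V := by
  intro x hx
  have hfin : eVariationOn g (Icc a b) ≠ ⊤ := ne_top_of_le_ne_top ENNReal.ofReal_ne_top hV
  have hgint : IntegrableOn (fun x => |g x|) (Icc c d) :=
    ((bv_integrableOn a b g hfin).mono_set hsub).abs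
  obtain ⟨y, hy, hgy⟩ : ∃ y ∈ Icc c d, |g y| ≤ 1 / (d - c) := by
    have hμ : volume (Icc c d) ≠ 0 := by simp [hcd]
    obtain ⟨y, hy, h⟩ := exists_le_setAverage hμ (by simp) hgint
    refine ⟨y, hy, h.trans ?_⟩
    rw [setAverage_eq, smul_eq_mul, Real.volume_real_Icc_of_le hcd.le, one_div]
    have : 0 ≤ (d - c)⁻¹ := by have := sub_pos.2 hcd; positivity
    nlinarith
  have h1 := BoundedVariationOn.dist_le (f := g) hfin hx (hsub hy)
  have h2 : (eVariationOn g (Icc a b)).toReal ≤ V := ENNReal.toReal_le_of_le_ofReal hV0 hV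
  rw [Real.dist_eq] at h1
  have h3 := abs_sub_abs_le_abs_sub (g x) (g y)
  linarith

lemma lsc_combine (c : ℝ≥0∞) (hc : c ≠ ⊤) (a b i : ℕ → ℝ≥0∞) (A B I : ℝ≥0∞)
    (hA : ∀ v < A, ∀ᶠ n in atTop, v < a n) (hB : ∀ v < B, ∀ᶠ n in atTop, v < b n)
    (hi : Tendsto i atTop (𝓝 I)) (h : ∀ n, c * (a n + b n) + i n ≤ 1) :
    c * (A + B) + I ≤ 1 := by
  obtain ⟨⟨a', b'⟩, φ, hφ, ht⟩ := CompactSpace.tendsto_subseq (fun n => (a n, b n))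
  have ha := (continuous_fst.tendsto _).comp ht
  have hb := (continuous_snd.tendsto _).comp ht
  have hA' : A ≤ a' := le_of_forall_lt fun v hv => by
    obtain ⟨w, hw1, hw2⟩ := exists_between hv
    exact hw1.trans_le (ge_of_tendsto ha
      ((hφ.tendsto_atTop.eventually (hA w hw2)).mono fun n hn => le_of_lt hn))
  have hB' : B ≤ b' := le_of_forall_lt fun v hv => by
    obtain ⟨w, hw1, hw2⟩ := exists_between hv
    exact hw1.trans_le (ge_of_tendsto hb
      ((hφ.tendsto_atTop.eventually (hB w hw2)).mono fun n hn => le_of_lt hn))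
  have : c * (a' + b') + I ≤ 1 := le_of_tendsto'
    ((ENNReal.Tendsto.const_mul (ha.add hb) (Or.inr hc)).add (hi.comp hφ.tendsto_atTop))
    (fun n => h (φ n))
  exact le_trans (by gcongr) this

lemma abs_rpow_integrable (a b δ : ℝ) (hδ : δ < 1) :
    IntegrableOn (fun x : ℝ => |x| ^ (-δ)) (Icc a b) := by
  rcases le_or_gt a b with hab | hab
  · have h := (intervalIntegral.intervalIntegrable_cpow' (a := a) (b := b) (r := ((-δ : ℝ) : ℂ))
      (by rw [Complex.ofReal_re]; linarith)).norm
    rw [intervalIntegrable_iff_integrableOn_Icc_of_le hab] at h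
    refine h.congr_fun (fun x _ => ?_) measurableSet_Icc
    simp only [Complex.norm_cpow_real, Complex.norm_real, Real.norm_eq_abs]
  · simp [Icc_eq_empty_of_lt hab]

lemma exists_index (K : ℕ) (α δ x : ℝ) (hα : 0 < α) (hδ : 0 < δ) (hx : 0 < x) (hx1 : x ≤ 1) :
    ∃ k ≥ K, 1 / ((k : ℝ) + α) ≤ x ∧ (k : ℝ) ^ δ ≤ ((K : ℝ) + 2) ^ δ * x ^ (-δ) := by
  refine ⟨K + ⌈1 / x⌉₊, by omega, ?_, ?_⟩
  · have h := Nat.le_ceil (1 / x)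
    have hK : (0 : ℝ) ≤ K := Nat.cast_nonneg K
    have hp : 0 < 1 / x := by positivity
    rw [div_le_iff₀ (by push_cast; linarith)]
    rw [div_le_iff₀ hx] at h
    push_cast
    nlinarith
  · rw [Real.rpow_neg hx.le, ← Real.inv_rpow hx.le, ← Real.mul_rpow (by positivity) (by positivity)]
    apply Real.rpow_le_rpow (by positivity) _ hδ.le
    have h := (Nat.ceil_lt_add_one (a := 1 / x) (by positivity)).le
    push_cast
    have h1 : 1 ≤ x⁻¹ := (one_le_inv₀ hx).2 hx1
    rw [one_div] at h ⊢
    nlinarith [(Nat.cast_nonneg K : (0:ℝ) ≤ K)]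

lemma kd_bounds (α : ℝ) (K : ℕ) (δ : ℝ) (g : ℝ → ℝ) (h : kdNorm α K δ g ≤ 1)
    (k : ℕ) (hk : K ≤ k) (hk1 : 1 ≤ k) :
    eVariationOn g (Icc (1 / (k + α)) α) ≤ ENNReal.ofReal ((k : ℝ) ^ δ) ∧
    eVariationOn g (Icc (α - 1) (-(1 / (k + α)))) ≤ ENNReal.ofReal ((k : ℝ) ^ δ) ∧
    ∫ x in Icc (α - 1) (-(1 / (k + α))) ∪ Icc (1 / (k + α)) α, |g x| ≤ 1 := by
  have h1 : ENNReal.ofReal ((k : ℝ) ^ (-δ)) *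
        (eVariationOn g (Icc (1 / (k + α)) α) + eVariationOn g (Icc (α - 1) (-(1 / (k + α))))) +
      ENNReal.ofReal (∫ x in Icc (α - 1) (-(1 / (k + α))) ∪ Icc (1 / (k + α)) α, |g x|) ≤ 1 :=
    (le_iSup₂ (f := fun (k : ℕ) (_ : K ≤ k) => ENNReal.ofReal ((k : ℝ) ^ (-δ)) *
        (eVariationOn g (Icc (1 / (k + α)) α) + eVariationOn g (Icc (α - 1) (-(1 / (k + α))))) +
      ENNReal.ofReal (∫ x in Icc (α - 1) (-(1 / (k + α))) ∪ Icc (1 / (k + α)) α, |g x|)) k hk).trans h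
  have hk0 : (0 : ℝ) < k := by exact_mod_cast hk1
  have hp : (0 : ℝ) < (k : ℝ) ^ δ := Real.rpow_pos_of_pos hk0 _
  have gen : ∀ v : ℝ≥0∞, ENNReal.ofReal ((k : ℝ) ^ (-δ)) * v ≤ 1 →
      v ≤ ENNReal.ofReal ((k : ℝ) ^ δ) := by
    intro v hv
    rw [Real.rpow_neg hk0.le, ENNReal.ofReal_inv_of_pos hp, mul_comm, ← div_eq_mul_inv] at hv
    rw [ENNReal.div_le_iff (by simpa using hp) ENNReal.ofReal_ne_top, one_mul] at hv
    exact hv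
  have h2 := le_self_add.trans h1
  have h3 := le_add_self.trans h1
  refine ⟨gen _ (le_trans (by gcongr; exact le_self_add) h2),
    gen _ (le_trans (by gcongr; exact le_add_self) h2), ?_⟩
  rwa [ENNReal.ofReal_le_one] at h3

lemma side_bounds (α : ℝ) (K : ℕ) (δ : ℝ) (hα : α ∈ Ioc (0:ℝ) 1) (hδ : 0 < δ) (hK : 1 ≤ K)
    (hr : 1 / (K + α) < α) (hl : α < 1 → 1 / (K + α) < 1 - α) (g : ℝ → ℝ)
    (h : kdNorm α K δ g ≤ 1) :
    (∀ x ∈ Ioc 0 α, eVariationOn g (Icc x α) ≤ ENNReal.ofReal (((K : ℝ) + 2) ^ δ * |x| ^ (-δ)) ∧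
      |g x| ≤ |1 / (α - 1 / (K + α))| + |1 / (1 - α - 1 / (K + α))|
        + ((K : ℝ) + 2) ^ δ * |x| ^ (-δ)) ∧
    (∀ x ∈ Ico (α - 1) 0,
      eVariationOn g (Icc (α - 1) x) ≤ ENNReal.ofReal (((K : ℝ) + 2) ^ δ * |x| ^ (-δ)) ∧
      |g x| ≤ |1 / (α - 1 / (K + α))| + |1 / (1 - α - 1 / (K + α))|
        + ((K : ℝ) + 2) ^ δ * |x| ^ (-δ)) := by
  have hα0 := hα.1
  obtain ⟨hK1, hK2, hK3⟩ := kd_bounds α K δ g h K le_rfl hK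
  have hi1 := (bv_integrableOn _ _ g (ne_top_of_le_ne_top ENNReal.ofReal_ne_top hK1)).abs
  have hi2 := (bv_integrableOn _ _ g (ne_top_of_le_ne_top ENNReal.ofReal_ne_top hK2)).abs
  have hi : IntegrableOn (fun x => |g x|)
    (Icc (α - 1) (-(1 / (K + α))) ∪ Icc (1 / (K + α)) α) := IntegrableOn.union hi2 hi1
  have hI1 : ∫ x in Icc (1 / (K + α)) α, |g x| ≤ 1 := le_trans
    (setIntegral_mono_set hi (Eventually.of_forall fun x => abs_nonneg _)
      (Eventually.of_forall (fun x hx => Or.inr hx))) hK3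
  have hI2 : ∫ x in Icc (α - 1) (-(1 / (K + α))), |g x| ≤ 1 := le_trans
    (setIntegral_mono_set hi (Eventually.of_forall fun x => abs_nonneg _)
      (Eventually.of_forall (fun x hx => Or.inl hx))) hK3
  have hmono : ∀ k ≥ K, 1 / ((k : ℝ) + α) ≤ 1 / (K + α) := fun k hk => by
    apply one_div_le_one_div_of_le (by positivity)
    have : (K : ℝ) ≤ k := by exact_mod_cast hk
    linarith
  constructor
  · intro x hx
    obtain ⟨k, hk, hkx, hkb⟩ := exists_index K α δ x hα0 hδ hx.1 (hx.2.trans hα.2)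
    obtain ⟨h1, -, -⟩ := kd_bounds α K δ g h k hk (hK.trans hk)
    rw [abs_of_pos hx.1]
    have h1' := h1.trans (ENNReal.ofReal_le_ofReal hkb)
    refine ⟨(eVariationOn.mono g (Icc_subset_Icc_left hkx)).trans h1', ?_⟩
    have := point_bound _ _ _ _ _ (by have := hx.1; positivity) hr
      (Icc_subset_Icc_left (hmono k hk)) g h1' hI1 x ⟨hkx, hx.2⟩
    linarith [le_abs_self (1 / (α - 1 / (K + α))), abs_nonneg (1 / (1 - α - 1 / (K + α)))]
  · intro x hx
    have hx0 : 0 < -x := neg_pos.2 hx.2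
    obtain ⟨k, hk, hkx, hkb⟩ := exists_index K α δ (-x) hα0 hδ hx0 (by linarith [hx.1])
    obtain ⟨-, h1, -⟩ := kd_bounds α K δ g h k hk (hK.trans hk)
    rw [abs_of_neg hx.2]
    have h1' := h1.trans (ENNReal.ofReal_le_ofReal hkb)
    have hkx' : x ≤ -(1 / ((k : ℝ) + α)) := by linarith
    refine ⟨(eVariationOn.mono g (Icc_subset_Icc_right hkx')).trans h1', ?_⟩
    have hlt := hl (by linarith [hx.1, hx.2])
    have := point_bound _ _ _ _ _ (by positivity) (by linarith)
      (Icc_subset_Icc_right (neg_le_neg (hmono k hk))) g h1' hI2 x ⟨hx.1, hkx'⟩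
    rw [show -(1 / ((K : ℝ) + α)) - (α - 1) = 1 - α - 1 / (K + α) by ring] at this
    linarith [le_abs_self (1 / (1 - α - 1 / (K + α))), abs_nonneg (1 / (α - 1 / (K + α)))]

/-- for `α ∈ (0,1]`, `0 < δ < 1` and `K` sufficiently large, the unit ball
of `B_{K,δ}` is compact in the `L¹([α-1,α])` topology: any sequence with `(K,δ)`-norm at
most `1` has a subsequence converging in `L¹` to a limit of `(K,δ)`-norm at most `1`. -/
theorem BKdelta_unit_ball_L1_compact (α : ℝ) (hα : α ∈ Ioc (0:ℝ) 1)
    (δ : ℝ) (hδ : δ ∈ Ioo (0:ℝ) 1) :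
    ∃ K₀ : ℕ, ∀ K ≥ K₀, ∀ f : ℕ → ℝ → ℝ,
      (∀ n, kdNorm α K δ (f n) ≤ 1) →
      ∃ φ : ℕ → ℕ, StrictMono φ ∧ ∃ F : ℝ → ℝ, kdNorm α K δ F ≤ 1 ∧
        Filter.Tendsto (fun n => ∫ x in Icc (α - 1) α, |f (φ n) x - F x|)
          Filter.atTop (nhds 0) := by
  have hα0 := hα.1
  obtain ⟨K₀, hK₀⟩ := exists_nat_gt (max 1 (max (1 / α) (1 / (1 - α))))
  refine ⟨K₀, fun K hK f hf => ?_⟩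
  have hKr : max 1 (max (1 / α) (1 / (1 - α))) < (K : ℝ) :=
    hK₀.trans_le (by exact_mod_cast hK)
  rw [max_lt_iff, max_lt_iff] at hKr
  obtain ⟨hk1, hk2, hk3⟩ := hKr
  have hK1 : 1 ≤ K := by exact_mod_cast hk1.le
  have hr : 1 / (K + α) < α := by
    rw [div_lt_iff₀ hα0] at hk2
    rw [div_lt_iff₀ (by positivity)]
    nlinarith
  have hl : α < 1 → 1 / (K + α) < 1 - α := fun h => by
    have h' : 0 < 1 - α := by linarith
    rw [div_lt_iff₀ h'] at hk3
    rw [div_lt_iff₀ (by positivity)]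
    nlinarith
  have hb := fun n => side_bounds α K δ hα hδ.1 hK1 hr hl (f n) (hf n)
  set C : ℝ := |1 / (α - 1 / (K + α))| + |1 / (1 - α - 1 / (K + α))| with hC
  set W : ℝ := ((K : ℝ) + 2) ^ δ with hW
  have hC0 : 0 ≤ C := by positivity
  have hV0 : ∀ x : ℝ, 0 ≤ W * |x| ^ (-δ) := fun x => by positivity
  let B : ℝ → ℝ := fun x => C + W * |x| ^ (-δ)
  have lbvR : ∀ n, LocallyBoundedVariationOn (f n) (Ioc 0 α) := fun n a b ha _ =>
    ne_top_of_le_ne_top ENNReal.ofReal_ne_top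
      ((eVariationOn.mono (s := Icc a α) _ (fun y hy => ⟨hy.2.1, hy.1.2⟩)).trans ((hb n).1 a ha).1)
  have lbvL : ∀ n, LocallyBoundedVariationOn (f n) (Ico (α - 1) 0) := fun n a b _ hb' =>
    ne_top_of_le_ne_top ENNReal.ofReal_ne_top
      ((eVariationOn.mono (s := Icc (α - 1) b) _ (fun y hy => ⟨hy.1.1, hy.2.2⟩)).trans ((hb n).2 b hb').1)
  obtain ⟨φ, hφ, P, hP⟩ := helly_bv (Ioc 0 α) ordConnected_Ioc α (fun _ => ⟨hα0, le_rfl⟩) f lbvR B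
    (fun n x hx => by
      rw [variationOnFromTo.eq_of_ge _ _ hx.2, abs_neg, ENNReal.abs_toReal]
      have := ENNReal.toReal_le_of_le_ofReal (hV0 x)
        ((eVariationOn.mono (f n) (inter_subset_right (s := Ioc 0 α))).trans ((hb n).1 x hx).1)
      simp only [B]; linarith)
    (fun n x hx => ((hb n).1 x hx).2)
  obtain ⟨ψ, hψ, Q, hQ⟩ := helly_bv (Ico (α - 1) 0) ordConnected_Ico (α - 1)
    (fun ⟨y, hy⟩ => ⟨le_rfl, hy.1.trans_lt hy.2⟩) (fun n => f (φ n)) (fun n => lbvL _) B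
    (fun n x hx => by
      rw [variationOnFromTo.eq_of_le _ _ hx.1, ENNReal.abs_toReal]
      have := ENNReal.toReal_le_of_le_ofReal (hV0 x)
        ((eVariationOn.mono (f (φ n)) (inter_subset_right (s := Ico (α - 1) 0))).trans
          ((hb (φ n)).2 x hx).1)
      simp only [B]; linarith)
    (fun n x hx => ((hb _).2 x hx).2)
  let S : Set ℝ := Ico (α - 1) 0 ∪ Ioc 0 α
  let g : ℕ → ℝ → ℝ := fun n => f (φ (ψ n))
  let F : ℝ → ℝ := fun x => if 0 < x then P x else Q x
  have hS : MeasurableSet S := measurableSet_Ico.union measurableSet_Ioc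
  have hlim : ∀ x ∈ S, Tendsto (fun n => g n x) atTop (𝓝 (F x)) := by
    rintro x (hx | hx)
    · simp only [F, if_neg (not_lt.2 hx.2.le)]
      exact hQ x hx
    · simp only [F, if_pos hx.1]
      exact (hP x hx).comp hψ.tendsto_atTop
  have hbd : ∀ n, ∀ x ∈ S, |g n x| ≤ B x := by
    rintro n x (hx | hx)
    · exact ((hb _).2 x hx).2
    · exact ((hb _).1 x hx).2
  have hFbd : ∀ x ∈ S, |F x| ≤ B x := fun x hx =>
    le_of_tendsto' (hlim x hx).abs (fun n => hbd n x hx)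
  have hmeas : ∀ n, AEMeasurable (g n) (volume.restrict S) := fun n =>
    aemeasurable_union_iff.2 ⟨lbv_aemeasurable _ measurableSet_Ico _ (lbvL _),
      lbv_aemeasurable _ measurableSet_Ioc _ (lbvR _)⟩
  have hFmeas : AEMeasurable F (volume.restrict S) :=
    aemeasurable_of_tendsto_metrizable_ae atTop hmeas
      ((ae_restrict_iff' hS).2 (Eventually.of_forall hlim))
  have hSI : S ⊆ Icc (α - 1) α := by
    rintro x (hx | hx)
    · exact ⟨hx.1, hx.2.le.trans hα0.le⟩
    · exact ⟨by linarith [hx.1, hα.2], hx.2⟩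
  have hBint : IntegrableOn B S := by
    refine IntegrableOn.mono_set (t := Icc (α - 1) α) ?_ hSI
    exact (integrableOn_const (by simp)).add
      ((abs_rpow_integrable _ _ δ hδ.2).const_mul W)
  refine ⟨φ ∘ ψ, hφ.comp hψ, F, ?_, ?_⟩
  · refine iSup₂_le fun k hk => ?_
    have hkp : 0 < 1 / ((k : ℝ) + α) := by positivity
    have hs1 : Icc (1 / ((k : ℝ) + α)) α ⊆ S := fun x hx => Or.inr ⟨hkp.trans_le hx.1, hx.2⟩
    have hs2 : Icc (α - 1) (-(1 / ((k : ℝ) + α))) ⊆ S := fun x hx =>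
      Or.inl ⟨hx.1, hx.2.trans_lt (neg_neg_of_pos hkp)⟩
    have hs := union_subset hs2 hs1
    refine lsc_combine _ ENNReal.ofReal_ne_top
      (fun n => eVariationOn (g n) (Icc (1 / ((k : ℝ) + α)) α))
      (fun n => eVariationOn (g n) (Icc (α - 1) (-(1 / ((k : ℝ) + α)))))
      (fun n => ENNReal.ofReal
        (∫ x in Icc (α - 1) (-(1 / ((k : ℝ) + α))) ∪ Icc (1 / (k + α)) α, |g n x|)) _ _ _
      (fun v hv => eVariationOn.lowerSemicontinuous_aux (fun x hx => hlim x (hs1 hx)) hv)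
      (fun v hv => eVariationOn.lowerSemicontinuous_aux (fun x hx => hlim x (hs2 hx)) hv)
      ?_ (fun n => le_trans (le_iSup₂ (f := fun (k : ℕ) (_ : K ≤ k) =>
        ENNReal.ofReal ((k : ℝ) ^ (-δ)) *
        (eVariationOn (g n) (Icc (1 / (k + α)) α)
          + eVariationOn (g n) (Icc (α - 1) (-(1 / (k + α))))) +
        ENNReal.ofReal
          (∫ x in Icc (α - 1) (-(1 / (k + α))) ∪ Icc (1 / (k + α)) α, |g n x|)) k hk) (hf _))
    refine ENNReal.tendsto_ofReal ?_
    have hms : MeasurableSet (Icc (α - 1) (-(1 / ((k : ℝ) + α))) ∪ Icc (1 / ((k : ℝ) + α)) α) :=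
      measurableSet_Icc.union measurableSet_Icc
    refine tendsto_integral_of_dominated_convergence B (fun n => ?_) (hBint.mono_set hs)
      (fun n => ?_) ?_
    · exact ((hmeas n).mono_set hs).aestronglyMeasurable.norm
    · refine (ae_restrict_iff' hms).2 (Eventually.of_forall fun x hx => ?_)
      rw [Real.norm_eq_abs, abs_abs]
      exact hbd n x (hs hx)
    · exact (ae_restrict_iff' hms).2 (Eventually.of_forall fun x hx => (hlim x (hs hx)).abs)
  · have hae : (Icc (α - 1) α : Set ℝ) =ᵐ[volume] S := by
      have h0 : (Icc (α - 1) α \ {0} : Set ℝ) =ᵐ[volume] Icc (α - 1) α :=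
        sdiff_null_ae_eq_self (by simp)
      have e : (Icc (α - 1) α \ {0} : Set ℝ) = S := by
        apply subset_antisymm
        · rintro x ⟨hx, hx0⟩
          rcases lt_or_gt_of_ne (show x ≠ 0 from hx0) with h | h
          · exact Or.inl ⟨hx.1, h⟩
          · exact Or.inr ⟨h, hx.2⟩
        · intro x hx
          refine ⟨hSI hx, ?_⟩
          rcases hx with hx | hx
          · exact hx.2.ne
          · exact hx.1.ne'
      rw [e] at h0
      exact h0.symm
    rw [Measure.restrict_congr_set hae]
    have := tendsto_integral_of_dominated_convergence (μ := volume.restrict S)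
      (F := fun n x => |g n x - F x|) (f := fun _ => (0:ℝ)) (fun x => B x + B x)
      (fun n => ((hmeas n).sub hFmeas).aestronglyMeasurable.norm) (hBint.add hBint)
      (fun n => (ae_restrict_iff' hS).2 (Eventually.of_forall fun x hx => by
        rw [Real.norm_eq_abs, abs_abs]
        exact (abs_sub _ _).trans (add_le_add (hbd n x hx) (hFbd x hx))))
      ((ae_restrict_iff' hS).2 (Eventually.of_forall fun x hx => by
        have := ((hlim x hx).sub_const (F x)).abs
        simpa using this))
    simpa using this
end
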